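/- Assume r ≥ 1. For every choice of alternating-symmetric families A = (A^{I_1…I_s}_{σ_1…σ_s,i_{s+1}…i_{n−1}})_{0 ≤ s ≤ n−1} of smooth functions on J^{r−1}, the associated Lagrangian L_A is variationally trivial: E_σ(L_A) = 0 on J^{2r} for every σ ∈ Fin m. -/

import Mathlib

open scoped BigOperators

namespace JetVar

/-- Multi-indices on `Fin n` of degree at most `r`. -/
abbrev MD (n r : ℕ) : Type := {J : Fin n → ℕ // (∑ i, J i) ≤ r}

noncomputable instance (n r : ℕ) : Fintype (MD n r) :=
  Fintype.ofInjective
    (fun J : MD n r => fun i : Fin n =>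
      (⟨J.1 i, Nat.lt_succ_of_le ((Finset.single_le_sum
        (fun j _ => Nat.zero_le (J.1 j)) (Finset.mem_univ i)).trans J.2)⟩ : Fin (r+1)))
    (fun _a _b h => Subtype.ext (funext fun i => congrArg Fin.val (congrFun h i)))

/-- Index set for the `y` coordinates of the `r`-th order jet space. -/
abbrev JIdx (n m r : ℕ) : Type := Fin m × MD n r

/-- The `r`-th order jet coordinate space. -/
abbrev Jet (n m r : ℕ) : Type := ((Fin n) → ℝ) × (JIdx n m r → ℝ)

variable {n m : ℕ}

/-- The coordinate `x^i`. -/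
def xc (i : Fin n) {r : ℕ} (p : Jet n m r) : ℝ := p.1 i

/-- The coordinate `y^σ_J` (with the convention that it is `0` for `|J| > r`). -/
def yc (σ : Fin m) (J : Fin n → ℕ) {r : ℕ} (p : Jet n m r) : ℝ :=
  if h : (∑ i, J i) ≤ r then p.2 (σ, ⟨J, h⟩) else 0

/-- Partial derivative along the coordinate direction `x^i`. -/
noncomputable def pdX (i : Fin n) {r : ℕ} (f : Jet n m r → ℝ) (p : Jet n m r) : ℝ :=
  fderiv ℝ f p (Pi.single i 1, 0)

/-- Partial derivative along the coordinate direction `y^σ_J`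
(by convention `0` for `|J| > r`). -/
noncomputable def pdY (σ : Fin m) (J : Fin n → ℕ) {r : ℕ} (f : Jet n m r → ℝ)
    (p : Jet n m r) : ℝ :=
  if h : (∑ i, J i) ≤ r then fderiv ℝ f p (0, Pi.single (σ, (⟨J, h⟩ : MD n r)) 1) else 0

/-- Projection `J^s → J^r` for `r ≤ s`, forgetting higher order coordinates. -/
def projJet {r s : ℕ} (h : r ≤ s) (p : Jet n m s) : Jet n m r :=
  (p.1, fun q => p.2 (q.1, ⟨q.2.1, q.2.2.trans h⟩))

/-- `J + e_i`. -/
def addE (J : Fin n → ℕ) (i : Fin n) : Fin n → ℕ := fun j => J j + (if j = i then 1 else 0)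

/-- `J - e_i` (truncated subtraction). -/
def subE (J : Fin n → ℕ) (i : Fin n) : Fin n → ℕ := fun j => J j - (if j = i then 1 else 0)

/-- The `i`-th formal (total) derivative of a function on `J^r`, a function on `J^{r+1}`. -/
noncomputable def formalD (i : Fin n) {r : ℕ} (f : Jet n m r → ℝ) (p : Jet n m (r+1)) : ℝ :=
  pdX i f (projJet (Nat.le_succ r) p)
    + ∑ q : JIdx n m r, yc q.1 (addE q.2.1 i) p * pdY q.1 q.2.1 f (projJet (Nat.le_succ r) p)

/-- Iterated formal derivatives along a list of directions. -/
noncomputable def formalDL {r : ℕ} : (l : List (Fin n)) → (Jet n m r → ℝ) →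
    (Jet n m (r + l.length) → ℝ)
  | [], f => f
  | i :: l, f => formalD i (formalDL l f)

/-- The canonical list of directions attached to a multi-index
(each `i` repeated `J i` times, in increasing order of `i`). -/
def mlist (J : Fin n → ℕ) : List (Fin n) :=
  (List.finRange n).flatMap (fun i => List.replicate (J i) i)

lemma mlist_length (J : Fin n → ℕ) : (mlist J).length = ∑ i, J i := by
  rw [mlist, List.length_flatMap]
  simp only [Function.comp_def, List.length_replicate]
  rw [Fin.sum_univ_def]

/-- The iterated formal derivative `d_I`, applying each `d_i` exactly `I i` times
(in increasing order of `i`); a function on `J^{r+|I|}`. -/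
noncomputable def formalDI (I : Fin n → ℕ) {r : ℕ} (f : Jet n m r → ℝ)
    (p : Jet n m (r + ∑ i, I i)) : ℝ :=
  formalDL (mlist I) f (projJet (le_of_eq (by rw [mlist_length])) p)

/-- The Lie–Euler expression `E^I_σ(L)` of a function `L` on `J^r`, a function on `J^{2r}`. -/
noncomputable def LieEuler {r : ℕ} (σ : Fin m) (I : Fin n → ℕ) (L : Jet n m r → ℝ)
    (p : Jet n m (2*r)) : ℝ :=
  ∑ J : MD n r,
    if h : (∑ i, (I i + J.1 i)) ≤ r then
      (-1:ℝ)^(∑ i, J.1 i) * (∏ i, (Nat.choose (I i + J.1 i) (I i) : ℝ)) *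
        formalDI J.1 (pdY σ (fun i => I i + J.1 i) L)
          (projJet (by have := J.2; omega) p)
    else 0

/-- The Euler–Lagrange expression `E_σ(L)`. -/
noncomputable def EL {r : ℕ} (σ : Fin m) (L : Jet n m r → ℝ) : Jet n m (2*r) → ℝ :=
  LieEuler σ (fun _ => 0) L


/-- The sign of a tuple `(i_1,…,i_n)` as a permutation of `Fin n`
(`0` if two entries coincide). -/
noncomputable def epsSign {n : ℕ} (v : Fin n → Fin n) : ℝ :=
  if h : Function.Bijective v then ((Equiv.Perm.sign (Equiv.ofBijective v h) : ℤ) : ℝ) else 0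

/-- The hyper-Jacobian `𝒥^{σ_1…σ_s, i_{s+1}…i_n}_{I_1…I_s}`, a function on `J^r`. -/
noncomputable def hyperJ {n m : ℕ} {r : ℕ} (s : ℕ) (hs : s ≤ n)
    (I : Fin s → (Fin n → ℕ)) (σs : Fin s → Fin m) (iv : Fin (n - s) → Fin n)
    (p : Jet n m r) : ℝ :=
  ∑ w : Fin s → Fin n,
    epsSign (fun a : Fin n => Fin.append w iv (Fin.cast (by omega) a)) *
      ∏ l : Fin s, yc (σs l) (addE (I l) (w l)) p

/-- The truncated formal derivative `δ_i` on functions on `J^t`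
(summing only over `|J| ≤ t − 1`). -/
noncomputable def truncD {n m : ℕ} {t : ℕ} (i : Fin n) (f : Jet n m t → ℝ)
    (p : Jet n m t) : ℝ :=
  pdX i f p + ∑ q : JIdx n m (t-1), yc q.1 (addE q.2.1 i) p * pdY q.1 q.2.1 f p

/-- Deleting the `k`-th entry of a tuple. -/
def delTup {α : Type*} {s : ℕ} (k : Fin s) (f : Fin s → α) : Fin (s-1) → α :=
  fun j =>
    if h : (j : ℕ) < (k : ℕ) then f ⟨j, by have := j.isLt; omega⟩
    else f ⟨(j : ℕ) + 1, by have := j.isLt; omega⟩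

/-- The type of families `A^{I_1…I_s}_{σ_1…σ_s, i_{s+1}…i_{n−1}}` of functions on
`J^{r−1}` (with `s` pairs and `n − s − 1` indices in `Fin n`). -/
def JetFam (n m r : ℕ) : Type :=
  (s : ℕ) → (Fin s → (Fin n → ℕ)) → (Fin s → Fin m) → (Fin (n - s - 1) → Fin n) →
    Jet n m (r-1) → ℝ

/-- Alternating-symmetry of a family: any simultaneous permutation of the pairs and any
permutation of the `Fin n` indices multiplies it by the sign of the permutation. -/
def IsAltSym {n m r : ℕ} (A : JetFam n m r) : Prop :=
  ∀ (s : ℕ) (τ : Equiv.Perm (Fin s)) (ρ : Equiv.Perm (Fin (n - s - 1)))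
    (I : Fin s → (Fin n → ℕ)) (σs : Fin s → Fin m) (iv : Fin (n - s - 1) → Fin n)
    (p : Jet n m (r-1)),
    A s (I ∘ τ) (σs ∘ τ) (iv ∘ ρ) p
      = ((Equiv.Perm.sign τ : ℤ) : ℝ) * ((Equiv.Perm.sign ρ : ℤ) : ℝ) * A s I σs iv p

/-- The coefficients `ℒ^{I_1…I_s}_{σ_1…σ_s, i_{s+1}…i_n}` associated to a family `A`. -/
noncomputable def Lcoef {n m r : ℕ} (A : JetFam n m r) (s : ℕ)
    (I : Fin s → (Fin n → ℕ)) (σs : Fin s → Fin m) (iv : Fin (n - s) → Fin n)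
    (p : Jet n m (r-1)) : ℝ :=
  (∑ k : Fin s, (-1:ℝ)^(k:ℕ) *
      pdY (σs k) (I k)
        (A (s-1) (delTup k I) (delTup k σs)
          (fun j : Fin (n - (s-1) - 1) =>
            iv (Fin.cast (by have := k.isLt; omega : n - (s-1) - 1 = n - s) j))) p)
  + (∑ k : Fin (n - s), (-1:ℝ)^((s:ℕ) + (k:ℕ)) *
      truncD (iv k) (A s I σs (delTup k iv)) p)

/-- The type of coefficient families `C^{I_1…I_s}_{σ_1…σ_s, i_{s+1}…i_n}` of functions
on `J^{r−1}` (with `s` pairs and `n − s` indices in `Fin n`). -/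
def CoefFam (n m r : ℕ) : Type :=
  (s : ℕ) → (Fin s → (Fin n → ℕ)) → (Fin s → Fin m) → (Fin (n - s) → Fin n) →
    Jet n m (r-1) → ℝ

/-- Alternating-symmetry for coefficient families. -/
def IsAltSymC {n m r : ℕ} (C : CoefFam n m r) : Prop :=
  ∀ (s : ℕ) (τ : Equiv.Perm (Fin s)) (ρ : Equiv.Perm (Fin (n - s)))
    (I : Fin s → (Fin n → ℕ)) (σs : Fin s → Fin m) (iv : Fin (n - s) → Fin n)
    (p : Jet n m (r-1)),
    C s (I ∘ τ) (σs ∘ τ) (iv ∘ ρ) p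
      = ((Equiv.Perm.sign τ : ℤ) : ℝ) * ((Equiv.Perm.sign ρ : ℤ) : ℝ) * C s I σs iv p

/-- The Lagrangian on `J^r` associated to a coefficient family, a hyper-Jacobian
polynomial in the highest-order derivatives. -/
noncomputable def LagC {n m r : ℕ} (C : CoefFam n m r) (p : Jet n m r) : ℝ :=
  ∑ s : Fin (n+1),
    (((s:ℕ).factorial * (n - (s:ℕ)).factorial : ℕ) : ℝ)⁻¹ *
      ∑ I : Fin (s:ℕ) → MD n (r-1), ∑ σs : Fin (s:ℕ) → Fin m,
        ∑ iv : Fin (n - (s:ℕ)) → Fin n,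
          (if ∀ l, (∑ i, (I l).1 i) = r - 1 then (1:ℝ) else 0) *
            C (s:ℕ) (fun l => (I l).1) σs iv (projJet (Nat.sub_le r 1) p) *
            hyperJ (s:ℕ) (by have := s.isLt; omega) (fun l => (I l).1) σs iv p

/-- The Lagrangian `L_A` associated to a family `A`. -/
noncomputable def LagA {n m r : ℕ} (A : JetFam n m r) : Jet n m r → ℝ :=
  LagC (fun s I σs iv => Lcoef A s I σs iv)

/-- The open subset `D^t_W` of `J^t` lying over an open set `W` of the total space. -/
def Dset {n m : ℕ} (t : ℕ) (W : Set (((Fin n) → ℝ) × ((Fin m) → ℝ))) :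
    Set (Jet n m t) :=
  {p | (p.1, fun σ => yc σ (fun _ => 0) p) ∈ W}

open Finset in
lemma leibniz_prod' {S : Type*} [CommRing S] [Algebra ℝ S] {ι : Type*} [DecidableEq ι]
    (D : Derivation ℝ S S) (s : Finset ι) (f : ι → S) :
    D (∏ i ∈ s, f i) = ∑ i ∈ s, (∏ j ∈ s.erase i, f j) * D (f i) := by
  induction s using Finset.induction_on with
  | empty => simp
  | insert a s ha ih =>
    rw [Finset.prod_insert ha, Derivation.leibniz, ih, Finset.sum_insert ha,
      Finset.erase_insert ha, smul_eq_mul, smul_eq_mul, add_comm, Finset.mul_sum]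
    congr 1
    refine Finset.sum_congr rfl fun i hi => ?_
    have hne : a ≠ i := fun h => ha (h ▸ hi)
    rw [Finset.erase_insert_of_ne hne, Finset.prod_insert (by simp [ha]), mul_assoc]

open Finset in
/-- A Jacobian determinant is a total divergence. -/
lemma jac_div {S : Type*} [CommRing S] [Algebra ℝ S] {ι : Type*} [Fintype ι] [DecidableEq ι]
    (D : ι → Derivation ℝ S S) (hc : ∀ i j f, D i (D j f) = D j (D i f)) (f : ι → S) (k0 : ι) :
    Matrix.det (Matrix.of fun k j => D j (f k)) =
      ∑ v : Equiv.Perm ι, (Equiv.Perm.sign v : ℤ) •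
        D (v k0) (f k0 * ∏ k ∈ univ.erase k0, D (v k) (f k)) := by
  have h1 : ∀ v : Equiv.Perm ι, D (v k0) (f k0 * ∏ k ∈ univ.erase k0, D (v k) (f k)) =
      (∏ k, D (v k) (f k)) + ∑ k ∈ univ.erase k0,
        f k0 * ((∏ l ∈ (univ.erase k0).erase k, D (v l) (f l)) * D (v k0) (D (v k) (f k))) := by
    intro v
    rw [Derivation.leibniz, leibniz_prod', smul_eq_mul, smul_eq_mul, Finset.mul_sum, add_comm]
    congr 1
    rw [mul_comm, Finset.mul_prod_erase univ (fun k => D (v k) (f k)) (mem_univ k0)]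
  simp_rw [h1, smul_add, Finset.sum_add_distrib, Finset.smul_sum]
  rw [← Matrix.det_transpose, Matrix.det_apply, Finset.sum_comm]
  refine left_eq_add.mpr ?_
  refine Finset.sum_eq_zero fun k hk => ?_
  have hk0 : k ≠ k0 := (Finset.mem_erase.mp hk).1
  refine Finset.sum_involution (fun v _ => v * Equiv.swap k0 k) ?_ ?_ ?_ ?_
  · intro v _
    have : ∏ l ∈ (univ.erase k0).erase k, D ((v * Equiv.swap k0 k) l) (f l)
        = ∏ l ∈ (univ.erase k0).erase k, D (v l) (f l) := by
      refine Finset.prod_congr rfl fun l hl => ?_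
      simp only [Finset.mem_erase] at hl
      rw [Equiv.Perm.mul_apply, Equiv.swap_apply_of_ne_of_ne hl.2.1 hl.1]
    rw [this]
    simp only [Equiv.Perm.mul_apply, Equiv.swap_apply_left, Equiv.swap_apply_right,
      Equiv.Perm.sign_mul, Equiv.Perm.sign_swap hk0.symm]
    rw [hc (v k) (v k0)]
    simp
  · intro v _ _ h
    have := mul_eq_left.mp h
    exact hk0 ((Equiv.swap_eq_one_iff.mp this).symm)
  · intros; simp
  · intro v _
    simp [mul_assoc]

lemma count_mlist (J : Fin n → ℕ) (i : Fin n) : (mlist J).count i = J i := by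
  rw [mlist, List.count_flatMap]
  simp only [Function.comp_def, List.count_replicate, beq_iff_eq]
  rw [← Fin.sum_univ_def]
  simp

lemma mlist_addE (J : Fin n → ℕ) (i : Fin n) : (mlist (addE J i)).Perm (i :: mlist J) := by
  rw [List.perm_iff_count]
  intro a
  rw [List.count_cons, count_mlist, count_mlist, addE]
  by_cases h : a = i
  · simp [h]
  · simp [h, Ne.symm h]

lemma sum_addE (J : Fin n → ℕ) (i : Fin n) : ∑ j, addE J i j = (∑ j, J j) + 1 := by
  simp [addE, Finset.sum_add_distrib]

lemma addE_inj {J K : Fin n → ℕ} {i : Fin n} (h : addE J i = addE K i) : J = K := by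
  funext j
  have := congrFun h j
  simpa [addE] using this

lemma addE_subE {K : Fin n → ℕ} {i : Fin n} (h : 1 ≤ K i) : addE (subE K i) i = K := by
  funext j
  simp only [addE, subE]
  by_cases hj : j = i
  · subst hj; simp; omega
  · simp [hj]

lemma addE_comm (J : Fin n → ℕ) (i j : Fin n) : addE (addE J i) j = addE (addE J j) i := by
  funext a; simp only [addE]; ring

section euler
variable {S : Type*} [CommRing S] [Algebra ℝ S]

/-- iterated derivative along a list -/
noncomputable def DL (D : Fin n → Derivation ℝ S S) (l : List (Fin n)) (f : S) : S :=
  l.foldr (fun i g => D i g) f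

lemma DL_perm (D : Fin n → Derivation ℝ S S) (hc : ∀ i j f, D i (D j f) = D j (D i f))
    {l l' : List (Fin n)} (h : l.Perm l') (f : S) : DL D l f = DL D l' f := by
  have : LeftCommutative (fun (i : Fin n) (g : S) => D i g) := ⟨fun a b f => hc a b f⟩
  exact h.foldr_eq f

lemma DL_comm (D : Fin n → Derivation ℝ S S) (hc : ∀ i j f, D i (D j f) = D j (D i f))
    (l : List (Fin n)) (i : Fin n) (f : S) : DL D l (D i f) = D i (DL D l f) := by
  induction l with
  | nil => rfl
  | cons a l ih =>
    change D a (DL D l (D i f)) = D i (D a (DL D l f))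
    rw [ih, hc]

lemma DL_add (D : Fin n → Derivation ℝ S S) (l : List (Fin n)) (f g : S) :
    DL D l (f + g) = DL D l f + DL D l g := by
  induction l with
  | nil => rfl
  | cons a l ih =>
    change D a (DL D l (f + g)) = D a (DL D l f) + D a (DL D l g)
    rw [ih, map_add]

lemma DL_smul (D : Fin n → Derivation ℝ S S) (l : List (Fin n)) (c : ℝ) (f : S) :
    DL D l (c • f) = c • DL D l f := by
  induction l with
  | nil => rfl
  | cons a l ih =>
    change D a (DL D l (c • f)) = c • D a (DL D l f)
    rw [ih, Derivation.map_smul]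

lemma DL_zero (D : Fin n → Derivation ℝ S S) (l : List (Fin n)) :
    DL D l 0 = 0 := by
  simpa using DL_smul D l 0 0

/-- Abstract Euler operator, as a linear map -/
noncomputable def EN (N : ℕ) (D : Fin n → Derivation ℝ S S)
    (P : (Fin n → ℕ) → Derivation ℝ S S) : S →ₗ[ℝ] S where
  toFun f := ∑ J : MD n N, ((-1:ℝ)^(∑ i, J.1 i)) • DL D (mlist J.1) (P J.1 f)
  map_add' f g := by
    simp only [map_add, DL_add, smul_add, Finset.sum_add_distrib]
  map_smul' c f := by
    simp only [Derivation.map_smul, DL_smul, Finset.smul_sum, RingHom.id_apply]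
    exact Finset.sum_congr rfl fun J _ => smul_comm _ _ _

lemma EN_div (N : ℕ) (D : Fin n → Derivation ℝ S S)
    (P : (Fin n → ℕ) → Derivation ℝ S S) (hc : ∀ i j f, D i (D j f) = D j (D i f))
    (hP1 : ∀ J i f, (∑ j, J j) ≤ N → P (addE J i) (D i f) = D i (P (addE J i) f) + P J f)
    (hP0 : ∀ J i f, J i = 0 → P J (D i f) = D i (P J f))
    (i : Fin n) (B : S) (hB : ∀ J, (∑ j, J j) = N + 1 → P J B = 0) :
    EN (N+1) D P (D i B) = 0 := by
  have key : ∀ J : Fin n → ℕ, P J (D i B) = D i (P J B) + (if 1 ≤ J i ∧ (∑ j, J j) ≤ N + 1 then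
      P (subE J i) B else P J (D i B) - D i (P J B)) := by
    intro J
    split_ifs with h
    · conv_lhs => rw [← addE_subE h.1]
      have := sum_addE (subE J i) i
      rw [addE_subE h.1] at this
      rw [hP1 _ _ _ (by omega), addE_subE h.1]
    · ring
  change ∑ J : MD n (N+1), ((-1:ℝ)^(∑ i, J.1 i)) • DL D (mlist J.1) (P J.1 (D i B)) = 0
  have h2 : ∀ J : MD n (N+1), ((-1:ℝ)^(∑ i, J.1 i)) • DL D (mlist J.1) (P J.1 (D i B)) =
      ((-1:ℝ)^(∑ i, J.1 i)) • DL D (mlist (addE J.1 i)) (P J.1 B) +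
      (if 1 ≤ J.1 i then ((-1:ℝ)^(∑ i, J.1 i)) • DL D (mlist J.1) (P (subE J.1 i) B) else 0) := by
    intro J
    rw [DL_perm D hc (mlist_addE J.1 i)]
    by_cases h : 1 ≤ J.1 i
    · rw [key, if_pos ⟨h, J.2⟩, if_pos h, DL_add, DL_comm D hc, smul_add]
      rfl
    · rw [if_neg h, hP0 _ _ _ (by omega), DL_comm D hc, add_zero]
      rfl
  simp_rw [h2, Finset.sum_add_distrib]
  have h3 := Fintype.sum_of_injective
    (fun J : MD n N => (⟨J.1, J.2.trans (Nat.le_succ N)⟩ : MD n (N+1)))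
    (fun a b h => Subtype.ext (congrArg (fun x : MD n (N+1) => x.1) h))
    (fun J => ((-1:ℝ)^(∑ i, J.1 i)) • DL D (mlist (addE J.1 i)) (P J.1 B))
    (fun J => ((-1:ℝ)^(∑ i, J.1 i)) • DL D (mlist (addE J.1 i)) (P J.1 B))
    (by
      intro J hJ
      have : (∑ j, J.1 j) = N + 1 := by
        by_contra hne
        exact hJ ⟨⟨J.1, by have := J.2; omega⟩, rfl⟩
      rw [hB _ this, DL_zero, smul_zero])
    (fun J => rfl)
  have h4 := Fintype.sum_of_injective
    (fun J : MD n N => (⟨addE J.1 i, by rw [sum_addE]; have := J.2; omega⟩ : MD n (N+1)))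
    (fun a b h => Subtype.ext (addE_inj (congrArg (fun x : MD n (N+1) => x.1) h)))
    (fun J => -(((-1:ℝ)^(∑ i, J.1 i)) • DL D (mlist (addE J.1 i)) (P J.1 B)))
    (fun J => (if 1 ≤ J.1 i then ((-1:ℝ)^(∑ i, J.1 i)) •
      DL D (mlist J.1) (P (subE J.1 i) B) else 0))
    (by
      intro J hJ
      rw [if_neg]
      intro h
      refine hJ ⟨⟨subE J.1 i, ?_⟩, Subtype.ext (addE_subE h)⟩
      have := sum_addE (subE J.1 i) i
      rw [addE_subE h] at this
      have := J.2
      omega)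
    (fun J => by
      have h1 : 1 ≤ addE J.1 i i := by simp [addE]
      have h2 : subE (addE J.1 i) i = J.1 := addE_inj (addE_subE h1)
      simp only [h1, if_true, h2, sum_addE, pow_succ]
      simp)
  rw [← h3, ← h4, Finset.sum_neg_distrib, add_neg_cancel]

end euler

section smoothalg

/-- smooth functions on the jet space -/
def SF (n m N : ℕ) : Subalgebra ℝ (Jet n m N → ℝ) where
  carrier := {f | ContDiff ℝ (⊤:ℕ∞) f}
  mul_mem' := fun {a b} ha hb =>
    ContDiff.mul (show ContDiff ℝ (⊤:ℕ∞) a from ha) (show ContDiff ℝ (⊤:ℕ∞) b from hb)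
  add_mem' := fun {a b} ha hb =>
    ContDiff.add (show ContDiff ℝ (⊤:ℕ∞) a from ha) (show ContDiff ℝ (⊤:ℕ∞) b from hb)
  algebraMap_mem' := fun c => (contDiff_const : ContDiff ℝ (⊤:ℕ∞) fun _ : Jet n m N => c)

lemma SF_diff {N : ℕ} (f : SF n m N) : Differentiable ℝ f.1 :=
  ContDiff.differentiable (show ContDiff ℝ (⊤:ℕ∞) f.1 from f.2) (by simp)

/-- derivation attached to a vector field -/
noncomputable def Dv {N : ℕ} (X : Jet n m N → Jet n m N) (hX : ContDiff ℝ (⊤:ℕ∞) X) :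
    Derivation ℝ (SF n m N) (SF n m N) where
  toFun f := ⟨fun p => fderiv ℝ f.1 p (X p),
    ((show ContDiff ℝ (⊤:ℕ∞) f.1 from f.2).fderiv_right (m := (⊤:ℕ∞)) (by simp)).clm_apply hX⟩
  map_add' f g := by
    apply Subtype.ext; funext p
    change fderiv ℝ (f.1 + g.1) p (X p) = fderiv ℝ f.1 p (X p) + fderiv ℝ g.1 p (X p)
    rw [fderiv_add (SF_diff f p) (SF_diff g p)]; rfl
  map_smul' c f := by
    apply Subtype.ext; funext p
    change fderiv ℝ (c • f.1) p (X p) = c • fderiv ℝ f.1 p (X p)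
    rw [fderiv_const_smul (SF_diff f p)]; rfl
  map_one_eq_zero' := by
    apply Subtype.ext; funext p
    change fderiv ℝ (fun _ => (1:ℝ)) p (X p) = 0
    simp
  leibniz' f g := by
    apply Subtype.ext; funext p
    change fderiv ℝ (f.1 * g.1) p (X p) = f.1 p * fderiv ℝ g.1 p (X p)
      + g.1 p * fderiv ℝ f.1 p (X p)
    rw [fderiv_mul (SF_diff f p) (SF_diff g p)]; rfl

lemma Dv_apply {N : ℕ} (X : Jet n m N → Jet n m N) (hX) (f : SF n m N) (p) :
    (Dv X hX f).1 p = fderiv ℝ f.1 p (X p) := rfl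

lemma Dv_comm {N : ℕ} (X Y : Jet n m N → Jet n m N) (hX hY) (f : SF n m N) (p) :
    (Dv X hX (Dv Y hY f)).1 p - fderiv ℝ f.1 p (fderiv ℝ Y p (X p))
      = (Dv Y hY (Dv X hX f)).1 p - fderiv ℝ f.1 p (fderiv ℝ X p (Y p)) := by
  have key : ∀ (X Y : Jet n m N → Jet n m N) (hX hY),
      (Dv X hX (Dv Y hY f)).1 p - fderiv ℝ f.1 p (fderiv ℝ Y p (X p))
        = fderiv ℝ (fderiv ℝ f.1) p (X p) (Y p) := by
    intro X Y hX hY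
    have hf : ContDiff ℝ (⊤:ℕ∞) f.1 := f.2
    have h1 : DifferentiableAt ℝ (fderiv ℝ f.1) p :=
      ((hf.fderiv_right (m := (⊤:ℕ∞)) (by simp)).differentiable (by simp)) p
    have h2 : DifferentiableAt ℝ Y p := (hY.differentiable (by simp)) p
    change fderiv ℝ (fun p => fderiv ℝ f.1 p (Y p)) p (X p) - _ = _
    rw [fderiv_clm_apply h1 h2]
    simp
  rw [key, key]
  have hs : IsSymmSndFDerivAt ℝ f.1 p :=
    ContDiffAt.isSymmSndFDerivAt (n := ((⊤:ℕ∞) : WithTop ℕ∞))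
      (ContDiff.contDiffAt f.2) (by
        rw [minSmoothness_of_isRCLikeNormedField]
        exact WithTop.coe_le_coe.mpr (le_top : (2:ℕ∞) ≤ ⊤))
  exact hs _ _

/-- the coordinate functional `y^σ_J` as a linear map -/
noncomputable def ycL (N : ℕ) (σ : Fin m) (J : Fin n → ℕ) : Jet n m N →L[ℝ] ℝ :=
  LinearMap.toContinuousLinearMap
    { toFun := fun p => yc σ J p
      map_add' := by intro p q; unfold yc; split_ifs <;> simp
      map_smul' := by intro c p; unfold yc; split_ifs <;> simp }

/-- linear part of the total derivative vector field -/
noncomputable def Vlin (N : ℕ) (i : Fin n) : Jet n m N →L[ℝ] Jet n m N :=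
  (0 : Jet n m N →L[ℝ] (Fin n → ℝ)).prod
    (ContinuousLinearMap.pi fun q : JIdx n m N => ycL N q.1 (addE q.2.1 i))

/-- the total derivative vector field -/
noncomputable def Vf (N : ℕ) (i : Fin n) (p : Jet n m N) : Jet n m N :=
  Vlin N i p + (Pi.single i 1, 0)

lemma Vf_eq (N : ℕ) (i : Fin n) (p : Jet n m N) :
    Vf N i p = (Pi.single i 1, fun q => yc q.1 (addE q.2.1 i) p) := by
  simp only [Vf, Vlin]
  ext <;> simp [ycL]

lemma Vlin_eq (N : ℕ) (i : Fin n) (p : Jet n m N) :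
    Vlin N i p = (0, fun q => yc q.1 (addE q.2.1 i) p) := rfl

lemma Vf_smooth (N : ℕ) (i : Fin n) : ContDiff ℝ (⊤:ℕ∞) (Vf (m := m) N i) :=
  ((Vlin N i).contDiff).add contDiff_const

lemma Vf_fderiv (N : ℕ) (i : Fin n) (p : Jet n m N) : fderiv ℝ (Vf N i) p = Vlin N i := by
  have : HasFDerivAt (Vf (m := m) N i) (Vlin N i) p :=
    ((Vlin N i).hasFDerivAt).add_const _
  exact this.fderiv

/-- the coordinate vector -/
noncomputable def Wv (N : ℕ) (σ : Fin m) (J : Fin n → ℕ) : Jet n m N :=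
  if h : (∑ i, J i) ≤ N then (0, Pi.single (σ, (⟨J, h⟩ : MD n N)) 1) else 0

noncomputable def Dt (N : ℕ) (i : Fin n) : Derivation ℝ (SF n m N) (SF n m N) :=
  Dv (Vf N i) (Vf_smooth N i)

noncomputable def Py (N : ℕ) (σ : Fin m) (J : Fin n → ℕ) : Derivation ℝ (SF n m N) (SF n m N) :=
  Dv (fun _ => Wv N σ J) contDiff_const

lemma Dt_comm (N : ℕ) (i j : Fin n) (f : SF n m N) : Dt N i (Dt N j f) = Dt N j (Dt N i f) := by
  apply Subtype.ext; funext p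
  have h := Dv_comm (Vf N i) (Vf N j) (Vf_smooth N i) (Vf_smooth N j) f p
  have e : ∀ i j : Fin n, Vlin N j (Vf (m := m) N i p) =
      (0, fun q => yc q.1 (addE (addE q.2.1 j) i) p) := by
    intro i j
    rw [Vlin_eq, Vf_eq]
    refine Prod.ext rfl ?_
    funext q
    change yc q.1 (addE q.2.1 j) ((Pi.single i 1, fun q => yc q.1 (addE q.2.1 i) p) : Jet n m N)
      = yc q.1 (addE (addE q.2.1 j) i) p
    by_cases h : ∑ a, addE q.2.1 j a ≤ N
    · rw [yc, dif_pos h]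
    · rw [yc, dif_neg h, yc, dif_neg]
      rw [sum_addE]; omega
  rw [Vf_fderiv, Vf_fderiv, e, e] at h
  simp_rw [addE_comm _ j i] at h
  exact sub_left_injective h

lemma yc_Wv (N : ℕ) (σ τ : Fin m) (J K : Fin n → ℕ) (hK : (∑ i, K i) ≤ N) :
    yc τ J (Wv N σ K) = if τ = σ ∧ J = K then 1 else 0 := by
  unfold yc Wv
  rw [dif_pos hK]
  split_ifs with h1 h2 h2
  · obtain ⟨rfl, rfl⟩ := h2
    simp
  · refine Pi.single_eq_of_ne ?_ _
    intro h
    exact h2 ⟨congrArg Prod.fst h, congrArg (fun x => x.2.1) h⟩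
  · obtain ⟨rfl, rfl⟩ := h2
    exact absurd hK h1
  · rfl

lemma Py_Dt (N : ℕ) (σ : Fin m) (J : Fin n → ℕ) (i : Fin n) (f : SF n m N) (p) :
    (Py N σ J (Dt N i f)).1 p = (Dt N i (Py N σ J f)).1 p +
      fderiv ℝ f.1 p (Vlin N i (Wv N σ J)) := by
  have h := Dv_comm (fun _ => Wv N σ J) (Vf N i) contDiff_const (Vf_smooth N i) f p
  rw [Vf_fderiv] at h
  simp only [fderiv_fun_const, Pi.zero_apply, zero_apply,
    map_zero, sub_zero] at h
  exact sub_eq_iff_eq_add.mp h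

lemma Py_Dt1 (N : ℕ) (σ : Fin m) (J : Fin n → ℕ) (i : Fin n) (f : SF n m (N+1))
    (hJ : (∑ j, J j) ≤ N) : Py (N+1) σ (addE J i) (Dt (N+1) i f) =
      Dt (N+1) i (Py (N+1) σ (addE J i) f) + Py (N+1) σ J f := by
  apply Subtype.ext; funext p
  rw [Py_Dt]
  change _ = _ + (Py (N+1) σ J f).1 p
  have e : (Py (N+1) σ J f).1 p = fderiv ℝ f.1 p (Wv (N+1) σ J) := rfl
  rw [e]
  congr 2
  rw [Vlin_eq]
  have hJ' : (∑ i, J i) ≤ N + 1 := by omega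
  have e2 : Wv (N+1) σ J = (0, Pi.single (σ, (⟨J, hJ'⟩ : MD n (N+1))) 1) := dif_pos hJ'
  rw [e2]
  refine Prod.ext rfl ?_
  funext q
  change yc _ _ _ = (Pi.single _ _ : _ → ℝ) q
  rw [yc_Wv _ _ _ _ _ (by rw [sum_addE]; omega), Pi.single_apply]
  congr 1
  apply propext
  constructor
  · rintro ⟨h1, h2⟩
    exact Prod.ext h1 (Subtype.ext (addE_inj h2))
  · rintro rfl; exact ⟨rfl, rfl⟩

lemma Py_Dt0 (N : ℕ) (σ : Fin m) (J : Fin n → ℕ) (i : Fin n) (f : SF n m N)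
    (hJ : J i = 0) : Py N σ J (Dt N i f) = Dt N i (Py N σ J f) := by
  apply Subtype.ext; funext p
  rw [Py_Dt]
  have : Vlin N i (Wv N σ J) = 0 := by
    by_cases h : (∑ i, J i) ≤ N
    · rw [Vlin_eq]
      refine Prod.ext rfl ?_
      funext q
      change yc _ _ _ = 0
      rw [yc_Wv _ _ _ _ _ h, if_neg]
      rintro ⟨-, h2⟩
      have := congrFun h2 i
      simp [addE, hJ] at this
    · rw [Wv, dif_neg h, map_zero]
  rw [this, map_zero, add_zero]

/-- coordinates as smooth functions -/
noncomputable def ySF (N : ℕ) (σ : Fin m) (J : Fin n → ℕ) : SF n m N :=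
  ⟨fun p => yc σ J p, show ContDiff ℝ (⊤:ℕ∞) (ycL N σ J) from (ycL N σ J).contDiff⟩

noncomputable def xSF (N : ℕ) (i : Fin n) : SF n m N :=
  ⟨fun p => p.1 i, by
    change ContDiff ℝ (⊤:ℕ∞) fun p : Jet n m N => p.1 i
    fun_prop⟩

lemma Dv_ySF {N : ℕ} (X : Jet n m N → Jet n m N) (hX) (σ : Fin m) (J : Fin n → ℕ) (p) :
    (Dv X hX (ySF N σ J)).1 p = yc σ J (X p) := by
  rw [Dv_apply]
  change fderiv ℝ (ycL N σ J) p (X p) = _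
  rw [ContinuousLinearMap.fderiv]; rfl

lemma Dv_xSF {N : ℕ} (X : Jet n m N → Jet n m N) (hX) (i : Fin n) (p) :
    (Dv X hX (xSF N i)).1 p = (X p).1 i := by
  rw [Dv_apply]
  have : HasFDerivAt (xSF N i : SF n m N).1 ((ContinuousLinearMap.proj i).comp
      (ContinuousLinearMap.fst ℝ (Fin n → ℝ) (JIdx n m N → ℝ))) p :=
    ((ContinuousLinearMap.proj i).comp
      (ContinuousLinearMap.fst ℝ (Fin n → ℝ) (JIdx n m N → ℝ))).hasFDerivAt
  rw [this.fderiv]; rfl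

lemma Dt_ySF {N : ℕ} (i : Fin n) (σ : Fin m) (J : Fin n → ℕ) (p) :
    (Dt N i (ySF N σ J)).1 p = yc σ (addE J i) p := by
  rw [Dt, Dv_ySF, Vf_eq]
  rw [yc]
  split_ifs with h
  · rfl
  · rw [yc, dif_neg]
    rw [sum_addE]; omega

lemma Dt_xSF {N : ℕ} (i j : Fin n) (p) :
    (Dt N i (xSF N j : SF n m N)).1 p = if j = i then 1 else 0 := by
  rw [Dt, Dv_xSF, Vf_eq]
  simp [Pi.single_apply]

lemma Py_ySF {N : ℕ} (σ τ : Fin m) (J K : Fin n → ℕ) (h : J ≠ K) :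
    Py N σ K (ySF N τ J) = 0 := by
  apply Subtype.ext; funext p
  rw [Py, Dv_ySF]
  by_cases hK : (∑ i, K i) ≤ N
  · rw [yc_Wv _ _ _ _ _ hK, if_neg (fun h' => h h'.2)]; rfl
  · rw [Wv, dif_neg hK]
    exact map_zero (ycL N τ J)

lemma Py_xSF {N : ℕ} (σ : Fin m) (K : Fin n → ℕ) (i : Fin n) :
    Py N σ K (xSF N i) = 0 := by
  apply Subtype.ext; funext p
  rw [Py, Dv_xSF, Wv]
  split_ifs <;> rfl

/-- projection as a continuous linear map -/
noncomputable def projL {s N : ℕ} (h : s ≤ N) : Jet n m N →L[ℝ] Jet n m s :=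
  LinearMap.toContinuousLinearMap
    { toFun := projJet h
      map_add' := fun _ _ => rfl
      map_smul' := fun _ _ => rfl }

/-- pullback of a smooth function -/
noncomputable def pull {s N : ℕ} (h : s ≤ N) (f : Jet n m s → ℝ) (hf : ContDiff ℝ (⊤:ℕ∞) f) :
    SF n m N :=
  ⟨fun p => f (projJet h p), hf.comp (projL h).contDiff⟩

lemma Dv_pull {s N : ℕ} (h : s ≤ N) (f : Jet n m s → ℝ) (hf) (X : Jet n m N → Jet n m N) (hX) (p) :
    (Dv X hX (pull h f hf)).1 p = fderiv ℝ f (projJet h p) (projJet h (X p)) := by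
  rw [Dv_apply]
  change fderiv ℝ (f ∘ projL h) p (X p) = _
  rw [fderiv_comp _ ((hf.differentiable (by simp)) _) (projL h).differentiableAt,
    ContinuousLinearMap.fderiv]
  rfl

lemma fderiv_Vec {s : ℕ} (f : Jet n m s → ℝ) (p : Jet n m s) (i : Fin n) (c : JIdx n m s → ℝ) :
    fderiv ℝ f p (Pi.single i 1, c) = pdX i f p + ∑ q : JIdx n m s, c q * pdY q.1 q.2.1 f p := by
  have h : ((Pi.single i 1, c) : Jet n m s) = (Pi.single i 1, 0) +
      ∑ q : JIdx n m s, c q • ((0, Pi.single q 1) : Jet n m s) := by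
    refine Prod.ext ?_ ?_
    · simp [Prod.fst_sum]
    · simp only [Prod.snd_add, Prod.snd_sum, zero_add, Prod.smul_snd]
      rw [← Finset.univ_sum_single c]
      simp [← Pi.single_smul]
  rw [h, map_add, map_sum]
  congr 1
  refine Finset.sum_congr rfl fun q _ => ?_
  rw [map_smul, smul_eq_mul, pdY, dif_pos q.2.2]

lemma projJet_Wv {s N : ℕ} (h : s ≤ N) (σ : Fin m) (J : Fin n → ℕ) :
    projJet h (Wv N σ J) = Wv s σ J := by
  by_cases hN : (∑ i, J i) ≤ N
  · refine Prod.ext (by simp [projJet, Wv, hN]; split_ifs <;> rfl) ?_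
    funext q
    have h1 : (projJet h (Wv N σ J)).2 q = yc q.1 q.2.1 (Wv N σ J) := by
      rw [yc, dif_pos (q.2.2.trans h)]; rfl
    rw [h1, yc_Wv _ _ _ _ _ hN]
    by_cases hs : (∑ i, J i) ≤ s
    · have h2 : (Wv s σ J).2 q = yc q.1 q.2.1 (Wv s σ J) := by
        rw [yc, dif_pos q.2.2]
      rw [h2, yc_Wv _ _ _ _ _ hs]
    · rw [if_neg, Wv, dif_neg hs]
      · rfl
      · rintro ⟨-, h3⟩
        exact hs (h3 ▸ q.2.2)
  · rw [Wv, dif_neg hN, Wv, dif_neg (by omega)]; rfl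

lemma Py_pull {s N : ℕ} (h : s ≤ N) (f : Jet n m s → ℝ) (hf) (σ : Fin m) (J : Fin n → ℕ) (p) :
    (Py N σ J (pull h f hf)).1 p = pdY σ J f (projJet h p) := by
  rw [Py, Dv_pull, projJet_Wv, Wv, pdY]
  split_ifs
  · rfl
  · rw [map_zero]

lemma pdY_smooth {s : ℕ} (f : Jet n m s → ℝ) (hf : ContDiff ℝ (⊤:ℕ∞) f) (σ : Fin m)
    (J : Fin n → ℕ) : ContDiff ℝ (⊤:ℕ∞) (pdY σ J f) := by
  have h := (Py s σ J (pull le_rfl f hf)).2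
  have e : (Py s σ J (pull le_rfl f hf)).1 = pdY σ J f := by
    funext p; rw [Py_pull]; rfl
  rw [e] at h
  exact h

lemma Dt_pull' {s N : ℕ} (h : s ≤ N) (f : Jet n m s → ℝ) (hf) (i : Fin n) (p) :
    (Dt N i (pull h f hf)).1 p = pdX i f (projJet h p) +
      ∑ q : JIdx n m s, yc q.1 (addE q.2.1 i) p * pdY q.1 q.2.1 f (projJet h p) := by
  rw [Dt, Dv_pull, Vf_eq]
  exact fderiv_Vec f _ i fun q => yc q.1 (addE q.2.1 i) p

lemma yc_proj {s N : ℕ} (h : s ≤ N) (σ : Fin m) (J : Fin n → ℕ) (hJ : (∑ i, J i) ≤ s)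
    (p : Jet n m N) : yc σ J (projJet h p) = yc σ J p := by
  rw [yc, dif_pos hJ, yc, dif_pos (hJ.trans h)]; rfl

lemma Dt_pull {s N : ℕ} (h : s + 1 ≤ N) (f : Jet n m s → ℝ) (hf) (i : Fin n) (p) :
    (Dt N i (pull (by omega) f hf)).1 p = formalD i f (projJet h p) := by
  rw [Dt_pull', formalD]
  congr 1
  refine Finset.sum_congr rfl fun q _ => ?_
  rw [yc_proj h _ _ (by rw [sum_addE]; have := q.2.2; omega)]
  rfl

lemma formalD_smooth {s : ℕ} (f : Jet n m s → ℝ) (hf : ContDiff ℝ (⊤:ℕ∞) f) (i : Fin n) :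
    ContDiff ℝ (⊤:ℕ∞) (formalD i f) := by
  have h := (Dt (s+1) i (pull (by omega) f hf)).2
  have e : (Dt (s+1) i (pull (by omega) f hf)).1 = formalD i f := by
    funext p; rw [Dt_pull le_rfl]; rfl
  rw [e] at h
  exact h

lemma formalDL_smooth {s : ℕ} (l : List (Fin n)) (f : Jet n m s → ℝ)
    (hf : ContDiff ℝ (⊤:ℕ∞) f) : ContDiff ℝ (⊤:ℕ∞) (formalDL l f) := by
  induction l with
  | nil => exact hf
  | cons i l ih => exact formalD_smooth _ ih i

lemma DL_pull {s N : ℕ} (l : List (Fin n)) (h : s + l.length ≤ N) (f : Jet n m s → ℝ) (hf) :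
    DL (Dt N) l (pull (by omega) f hf) =
      pull h (formalDL l f) (formalDL_smooth l f hf) := by
  induction l with
  | nil => rfl
  | cons i l ih =>
    change Dt N i (DL (Dt N) l _) = _
    rw [ih (by simp at h; omega)]
    apply Subtype.ext; funext p
    rw [Dt_pull (by simp at h; omega)]
    rfl

noncomputable def ENN (N : ℕ) (σ : Fin m) : SF n m N →ₗ[ℝ] SF n m N :=
  EN (n := n) (S := SF n m N) N (fun i => Dt N i) (fun J => Py N σ J)

lemma ENN_apply (N : ℕ) (σ : Fin m) (f : SF n m N) (p : Jet n m N) : (ENN N σ f).1 p =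
      ∑ J : MD n N, ((-1:ℝ)^(∑ i, J.1 i)) *
        (DL (Dt N) (mlist J.1) (Py N σ J.1 f)).1 p := by
  have h : ENN N σ f = ∑ J : MD n N, ((-1:ℝ)^(∑ i, J.1 i)) •
    DL (Dt N) (mlist J.1) (Py N σ J.1 f) := rfl
  rw [h, AddSubmonoidClass.coe_finsetSum, Finset.sum_apply]
  rfl

/-- The Euler-Lagrange expression in terms of the abstract Euler operator -/
lemma EL_eq {r : ℕ} (σ : Fin m) (L : Jet n m r → ℝ) (hL : ContDiff ℝ (⊤:ℕ∞) L)
    (p : Jet n m (2*r)) :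
    EL σ L p = (ENN (2*r) σ (pull (by omega) L hL)).1 p := by
  have h1' : ∀ f : SF n m (2*r), (ENN (2*r) σ f).1 p =
      ∑ J : MD n (2*r), ((-1:ℝ)^(∑ i, J.1 i)) *
        (DL (Dt (2*r)) (mlist J.1) (Py (2*r) σ J.1 f)).1 p := fun f => ENN_apply _ σ f p
  have h1 : (ENN (2*r) σ (pull (by omega) L hL)).1 p =
      ∑ J : MD n (2*r), ((-1:ℝ)^(∑ i, J.1 i)) *
        (DL (Dt (2*r)) (mlist J.1) (Py (2*r) σ J.1 (pull (by omega) L hL))).1 p := by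
    exact h1' _
  have hP : ∀ J : Fin n → ℕ, Py (2*r) σ J (pull (by omega) L hL) =
      pull (by omega) (pdY σ J L) (pdY_smooth L hL σ J) := by
    intro J
    apply Subtype.ext; funext q
    rw [Py_pull]; rfl
  rw [h1, EL, LieEuler]
  refine Fintype.sum_of_injective
    (fun J : MD n r => (⟨J.1, by have := J.2; omega⟩ : MD n (2*r)))
    (fun a b h => Subtype.ext (congrArg (fun x : MD n (2*r) => x.1) h)) _ _ ?_ ?_
  · intro J hJ
    have : ¬ (∑ j, J.1 j) ≤ r := by
      intro hle
      exact hJ ⟨⟨J.1, hle⟩, rfl⟩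
    have h0 : Py (2*r) σ J.1 (pull (by omega) L hL) = 0 := by
      apply Subtype.ext; funext q
      rw [Py_pull, pdY, dif_neg this]; rfl
    rw [h0, DL_zero]
    exact mul_zero _
  · intro J
    have hJ := J.2
    simp only [zero_add, Nat.choose_zero_right, Nat.cast_one, Finset.prod_const_one, mul_one]
    rw [dif_pos hJ, hP, DL_pull _ (by rw [mlist_length]; omega)]
    rfl

end smoothalg

section comb

/-- prepend an entry -/
def consT {α : Type*} {N : ℕ} (j : α) (w : Fin (N-1) → α) : Fin N → α :=
  fun i => if h : (i:ℕ) = 0 then j else w ⟨(i:ℕ) - 1, by have := i.isLt; omega⟩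

lemma delTup_map {α β : Type*} {s : ℕ} (k : Fin s) (f : Fin s → α) (φ : α → β) :
    delTup k (fun l => φ (f l)) = fun l => φ (delTup k f l) := by
  funext j
  simp only [delTup]
  split_ifs <;> rfl

lemma delTup_succ {α : Type*} {N : ℕ} (k : Fin (N+1)) (f : Fin (N+1) → α) (j : Fin N) :
    delTup k f j = f (k.succAbove j) := by
  simp only [delTup]
  split_ifs with h
  · congr 1
    rw [Fin.succAbove_of_castSucc_lt]
    · rfl
    · exact h
  · congr 1
    rw [Fin.succAbove_of_le_castSucc]
    · rfl
    · exact not_lt.mp h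

lemma alt_sum_aux {α : Type*} [Fintype α] [DecidableEq α] (N : ℕ)
    (g : α → (Fin N → α) → ℝ) (H : (Fin (N+1) → α) → ℝ)
    (hH : ∀ (τ : Equiv.Perm (Fin (N+1))) v,
      H (v ∘ τ) = ((Equiv.Perm.sign τ : ℤ) : ℝ) * H v) :
    ∑ v : Fin (N+1) → α, (∑ k : Fin (N+1), (-1:ℝ)^(k:ℕ) * g (v k) (fun j => v (k.succAbove j)))
      * H v = ((N+1 : ℕ) : ℝ) * ∑ j, ∑ w : Fin N → α, g j w * H (Fin.cons j w) := by
  simp_rw [Finset.sum_mul]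
  rw [Finset.sum_comm]
  have h1 : ∀ k : Fin (N+1), ∑ v : Fin (N+1) → α,
      (-1:ℝ)^(k:ℕ) * g (v k) (fun j => v (k.succAbove j)) * H v =
      ∑ j, ∑ w : Fin N → α, g j w * H (Fin.cons j w) := by
    intro k
    have h2 := (Equiv.arrowCongr k.cycleRange.symm (Equiv.refl α)).sum_comp
      (fun v : Fin (N+1) → α => (-1:ℝ)^(k:ℕ) * g (v k) (fun j => v (k.succAbove j)) * H v)
    rw [← h2, ← Fintype.sum_prod_type', ← (Fin.consEquiv (fun _ => α)).sum_comp]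
    refine Finset.sum_congr rfl fun x _ => ?_
    obtain ⟨j, w⟩ := x
    have e : (Equiv.arrowCongr k.cycleRange.symm (Equiv.refl α))
        ((Fin.consEquiv (fun _ => α)) (j, w)) = (Fin.cons j w : Fin (N+1) → α) ∘ k.cycleRange := by
      funext i
      simp [Equiv.arrowCongr, Fin.consEquiv]
    rw [e, hH, Fin.sign_cycleRange]
    simp only [Function.comp_apply, Fin.cycleRange_self, Fin.cons_zero, Fin.cycleRange_succAbove,
      Fin.cons_succ]
    have h3 : ((-1:ℝ)^(k:ℕ)) * ((-1:ℝ)^(k:ℕ)) = 1 := by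
      rw [← mul_pow]; simp
    push_cast
    linear_combination (g j w * H (Fin.cons j w)) * h3
  rw [Finset.sum_congr rfl fun k _ => h1 k]
  simp

lemma alt_sum {α : Type*} [Fintype α] [DecidableEq α] (N : ℕ) (hN : 0 < N)
    (g : α → (Fin (N-1) → α) → ℝ) (H : (Fin N → α) → ℝ)
    (hH : ∀ (τ : Equiv.Perm (Fin N)) v, H (v ∘ τ) = ((Equiv.Perm.sign τ : ℤ) : ℝ) * H v) :
    ∑ v : Fin N → α, (∑ k : Fin N, (-1:ℝ)^(k:ℕ) * g (v k) (delTup k v)) * H v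
      = (N : ℝ) * ∑ j, ∑ w : Fin (N-1) → α, g j w * H (consT j w) := by
  obtain ⟨N, rfl⟩ : ∃ M, N = M + 1 := ⟨N - 1, by omega⟩
  have h := alt_sum_aux N g H hH
  have e1 : ∀ (k : Fin (N+1)) (v : Fin (N+1) → α), (fun j => v (k.succAbove j)) = delTup k v := by
    intro k v; funext j; exact (delTup_succ k v j).symm
  have e2 : ∀ (j : α) (w : Fin N → α), (Fin.cons j w : Fin (N+1) → α) = consT j w := by
    intro j w; funext i
    refine Fin.cases ?_ (fun i => ?_) i
    · simp [consT]
    · simp [consT]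
  simp_rw [e1, e2] at h
  exact h

/-- index equivalence -/
def eqv {n : ℕ} (s : ℕ) (hs : s ≤ n) : Fin s ⊕ Fin (n - s) ≃ Fin n :=
  finSumFinEquiv.trans (finCongr (by omega))

/-- concatenation of tuples -/
def rows {α : Type*} {n : ℕ} (s : ℕ) (u : Fin s → α) (w : Fin (n - s) → α) : Fin n → α :=
  fun k => if h : (k:ℕ) < s then u ⟨k, h⟩ else w ⟨(k:ℕ) - s, by have := k.isLt; omega⟩

lemma rows_inl {α : Type*} {n : ℕ} (s : ℕ) (hs : s ≤ n) (u : Fin s → α) (w : Fin (n - s) → α)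
    (a) : rows s u w (eqv s hs (Sum.inl a)) = u a := by
  simp [rows, eqv]

lemma rows_inr {α : Type*} {n : ℕ} (s : ℕ) (hs : s ≤ n) (u : Fin s → α) (w : Fin (n - s) → α)
    (a) : rows s u w (eqv s hs (Sum.inr a)) = w a := by
  simp [rows, eqv]

lemma append_eq_rows {n : ℕ} {α : Type*} (s : ℕ) (hs : s ≤ n) (u : Fin s → α)
    (w : Fin (n - s) → α) (h : n = s + (n - s)) :
    (fun a : Fin n => Fin.append u w (Fin.cast h a)) = rows s u w := by
  funext a
  obtain ⟨b, rfl⟩ := (eqv s hs).surjective a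
  rcases b with b | b
  · rw [rows_inl]
    have : Fin.cast h (eqv s hs (Sum.inl b)) = Fin.castAdd (n - s) b := by
      apply Fin.ext; simp [eqv]
    rw [this, Fin.append_left]
  · rw [rows_inr]
    have : Fin.cast h (eqv s hs (Sum.inr b)) = Fin.natAdd s b := by
      apply Fin.ext; simp [eqv]
    rw [this, Fin.append_right]

lemma rows_comp {α : Type*} {n : ℕ} (s : ℕ) (hs : s ≤ n) (u : Fin s → α) (w : Fin (n - s) → α)
    (τ : Equiv.Perm (Fin s)) (ρ : Equiv.Perm (Fin (n - s))) :
    rows s (u ∘ τ) (w ∘ ρ) = rows s u w ∘ ((eqv s hs).permCongr (Equiv.Perm.sumCongr τ ρ)) := by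
  funext a
  obtain ⟨b, rfl⟩ := (eqv s hs).surjective a
  rcases b with b | b
  · rw [rows_inl]; simp [rows_inl]
  · rw [rows_inr]; simp [rows_inr]

lemma det_rows_comp {n : ℕ} (s : ℕ) (hs : s ≤ n) (u : Fin s → Fin n → ℝ)
    (w : Fin (n - s) → Fin n → ℝ)
    (τ : Equiv.Perm (Fin s)) (ρ : Equiv.Perm (Fin (n - s))) :
    Matrix.det (Matrix.of (rows s (u ∘ τ) (w ∘ ρ))) =
      ((Equiv.Perm.sign τ : ℤ) : ℝ) * ((Equiv.Perm.sign ρ : ℤ) : ℝ) *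
        Matrix.det (Matrix.of (rows s u w)) := by
  rw [rows_comp s hs]
  have := Matrix.det_permute ((eqv s hs).permCongr (Equiv.Perm.sumCongr τ ρ))
    (Matrix.of (rows s u w))
  rw [Equiv.Perm.sign_permCongr, Equiv.Perm.sign_sumCongr] at this
  push_cast at this
  exact this

lemma det_eq_eps {n : ℕ} (M : Fin n → Fin n → ℝ) :
    Matrix.det (Matrix.of M) = ∑ v : Fin n → Fin n, epsSign v * ∏ k, M k (v k) := by
  rw [← Matrix.det_transpose, Matrix.det_apply']
  refine Fintype.sum_of_injective (fun σ : Equiv.Perm (Fin n) => (σ : Fin n → Fin n))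
    (fun a b h => Equiv.ext (congrFun h)) _ _ ?_ ?_
  · intro v hv
    rw [epsSign, dif_neg, zero_mul]
    intro h
    exact hv ⟨Equiv.ofBijective v h, rfl⟩
  · intro σ
    rw [epsSign, dif_pos σ.bijective]
    have : Equiv.ofBijective (σ : Fin n → Fin n) σ.bijective = σ := Equiv.ext fun _ => rfl
    rw [this]
    rfl

lemma hyperJ_eq {n m r : ℕ} (s : ℕ) (hs : s ≤ n)
    (I : Fin s → (Fin n → ℕ)) (σs : Fin s → Fin m) (iv : Fin (n - s) → Fin n)
    (p : Jet n m r) :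
    hyperJ s hs I σs iv p = Matrix.det (Matrix.of (rows s
      (fun l j => yc (σs l) (addE (I l) j) p)
      (fun k => (Pi.single (iv k) 1 : Fin n → ℝ)))) := by
  rw [det_eq_eps, hyperJ]
  refine Fintype.sum_of_injective (fun w : Fin s → Fin n => rows s w iv) ?_ _ _ ?_ ?_
  · intro a b h
    funext l
    have := congrFun h (eqv s hs (Sum.inl l))
    simpa only [rows_inl] using this
  · intro v hv
    have : ∃ b, v (eqv s hs (Sum.inr b)) ≠ iv b := by
      by_contra hne
      push Not at hne
      refine hv ⟨fun l => v (eqv s hs (Sum.inl l)), ?_⟩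
      funext a
      obtain ⟨b, rfl⟩ := (eqv s hs).surjective a
      rcases b with b | b
      · exact rows_inl _ _ _ _ _
      · exact (rows_inr _ _ _ _ _).trans (hne b).symm
    obtain ⟨b, hb⟩ := this
    rw [Finset.prod_eq_zero (Finset.mem_univ (eqv s hs (Sum.inr b))), mul_zero]
    rw [rows_inr, Pi.single_eq_of_ne hb]
  · intro w
    rw [append_eq_rows s hs]
    congr 1
    rw [← (eqv s hs).prod_comp, Fintype.prod_sum_type]
    simp [rows_inl, rows_inr]

/-- matrix with distinguished first row -/
def Mat {α : Type*} {n : ℕ} (s : ℕ) (u : Fin s → α) (w : Fin (n - s - 1) → α) (v : α) :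
    Fin n → α :=
  fun k => if _h0 : (k:ℕ) = 0 then v else
    if h : (k:ℕ) - 1 < s then u ⟨(k:ℕ) - 1, h⟩
    else w ⟨(k:ℕ) - 1 - s, by have := k.isLt; omega⟩

lemma rows_cons_left {α : Type*} {n : ℕ} (s : ℕ) (u : Fin s → α)
    (w : Fin (n - s - 1) → α) (v : α) :
    rows (n := n) (s+1) (consT v u) w = Mat s u w v := by
  funext k
  simp only [rows, Mat, consT]
  split_ifs <;> first | rfl | omega | skip
  congr 1
  apply Fin.ext
  simp only
  omega

lemma det_rows_cons_right {n : ℕ} (s : ℕ) (hs : s < n) (u : Fin s → Fin n → ℝ)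
    (w : Fin (n - s - 1) → Fin n → ℝ) (v : Fin n → ℝ) :
    Matrix.det (Matrix.of (rows (n := n) s u (consT v w))) =
      (-1)^s * Matrix.det (Matrix.of (Mat s u w v)) := by
  obtain ⟨n', rfl⟩ : ∃ M, n = M + 1 := ⟨n - 1, by omega⟩
  have h := Matrix.det_permute (Fin.cycleRange (⟨s, hs⟩ : Fin (n'+1)))
    (Matrix.of (Mat s u w v))
  rw [Fin.sign_cycleRange] at h
  push_cast at h
  rw [← h]
  congr 1
  have e : rows s u (consT v w) ∘ (Fin.cycleRange (⟨s, hs⟩ : Fin (n'+1))).symm =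
      Mat s u w v := by
    funext k
    refine Fin.cases ?_ (fun k => ?_) k
    · simp [rows, Mat, consT]
    · simp only [Function.comp_apply, Fin.cycleRange_symm_succ]
      by_cases hk : (k:ℕ) < s
      · rw [Fin.succAbove_of_castSucc_lt _ _ hk]
        simp [rows, Mat, hk]
      · rw [Fin.succAbove_of_le_castSucc _ _ (not_lt.mp hk)]
        have h1 : ¬ ((k:ℕ) + 1 < s) := by omega
        have h2 : ¬ ((k:ℕ) + 1 - s = 0) := by omega
        simp only [rows, Mat, consT, Fin.val_succ, h1, h2, dif_neg, not_false_eq_true]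
        simp only [Nat.add_sub_cancel, hk, dite_false, Nat.succ_ne_zero]
        congr 1
        apply Fin.ext
        simp only
        omega
  have e' : rows s u (consT v w) = Mat s u w v ∘ (Fin.cycleRange (⟨s, hs⟩ : Fin (n'+1))) := by
    rw [← e]; funext k; simp
  rw [e']
  rfl

lemma Mat_update {α : Type*} {n : ℕ} (hn : 0 < n) (s : ℕ) (u : Fin s → α)
    (w : Fin (n - s - 1) → α) (v v' : α) :
    Mat s u w v' = Function.update (Mat (n := n) s u w v) ⟨0, hn⟩ v' := by
  funext k
  by_cases hk : k = ⟨0, hn⟩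
  · subst hk; simp [Mat]
  · rw [Function.update_of_ne hk]
    have : (k:ℕ) ≠ 0 := fun h => hk (Fin.ext h)
    simp [Mat, this]

lemma det_Mat_add {n : ℕ} (hn : 0 < n) (s : ℕ) (u : Fin s → Fin n → ℝ)
    (w : Fin (n - s - 1) → Fin n → ℝ) (v v' : Fin n → ℝ) :
    Matrix.det (Matrix.of (Mat s u w (v + v'))) =
      Matrix.det (Matrix.of (Mat s u w v)) + Matrix.det (Matrix.of (Mat s u w v')) := by
  have := Matrix.det_updateRow_add (Matrix.of (Mat s u w 0)) ⟨0, hn⟩ v v'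
  rw [Mat_update hn s u w 0 (v + v'), Mat_update hn s u w 0 v, Mat_update hn s u w 0 v']
  exact this

lemma det_Mat_smul {n : ℕ} (hn : 0 < n) (s : ℕ) (u : Fin s → Fin n → ℝ)
    (w : Fin (n - s - 1) → Fin n → ℝ) (c : ℝ) (v : Fin n → ℝ) :
    Matrix.det (Matrix.of (Mat s u w (c • v))) =
      c * Matrix.det (Matrix.of (Mat s u w v)) := by
  have := Matrix.det_updateRow_smul (Matrix.of (Mat s u w 0)) ⟨0, hn⟩ c v
  rw [Mat_update hn s u w 0 (c • v), Mat_update hn s u w 0 v]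
  exact this

lemma det_Mat_sum {n : ℕ} (hn : 0 < n) (s : ℕ) (u : Fin s → Fin n → ℝ)
    (w : Fin (n - s - 1) → Fin n → ℝ) {κ : Type*} (t : Finset κ) (c : κ → ℝ)
    (v : κ → Fin n → ℝ) :
    Matrix.det (Matrix.of (Mat s u w (∑ q ∈ t, c q • v q))) =
      ∑ q ∈ t, c q * Matrix.det (Matrix.of (Mat s u w (v q))) := by
  classical
  induction t using Finset.induction_on with
  | empty => simpa using det_Mat_smul hn s u w 0 0
  | insert a t ha ih =>
    rw [Finset.sum_insert ha, Finset.sum_insert ha, det_Mat_add hn, det_Mat_smul hn, ih]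

end comb

section mainformula

/-- pair index -/
abbrev PI (n m r : ℕ) : Type := MD n (r-1) × Fin m

open Classical in
noncomputable def ind1 {n m r : ℕ} (q : PI n m r) : ℝ :=
  if (∑ i, q.1.1 i) = r - 1 then 1 else 0

open Classical in
noncomputable def indP {n m r s : ℕ} (P : Fin s → PI n m r) : ℝ :=
  if ∀ l, (∑ i, (P l).1.1 i) = r - 1 then 1 else 0

lemma indP_perm {n m r s : ℕ} (P : Fin s → PI n m r) (τ : Equiv.Perm (Fin s)) :
    indP (P ∘ τ) = indP P := by
  unfold indP
  congr 1
  apply propext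
  exact τ.forall_congr_left.trans (by simp)

lemma indP_cons {n m r s : ℕ} (q : PI n m r) (P : Fin s → PI n m r) :
    indP (consT (N := s+1) q P) = ind1 q * indP P := by
  unfold indP ind1
  have : (∀ l, (∑ i, (consT (N := s+1) q P l).1.1 i) = r - 1) ↔
      (∑ i, q.1.1 i) = r - 1 ∧ ∀ l, (∑ i, (P l).1.1 i) = r - 1 := by
    rw [Fin.forall_fin_succ]
    simp [consT]
  by_cases h1 : (∑ i, q.1.1 i) = r - 1 <;>
    by_cases h2 : ∀ l, (∑ i, (P l).1.1 i) = r - 1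
  · rw [if_pos (this.mpr ⟨h1, h2⟩), if_pos h1, if_pos h2, mul_one]
  · rw [if_neg (fun h => h2 (this.mp h).2), if_neg h2, mul_zero]
  · rw [if_neg (fun h => h1 (this.mp h).1), if_neg h1, zero_mul]
  · rw [if_neg (fun h => h1 (this.mp h).1), if_neg h1, zero_mul]

/-- the smooth component functions of the family -/
noncomputable def Acomp {n m r : ℕ} (A : JetFam n m r) (s : ℕ) (P : Fin s → PI n m r)
    (iv : Fin (n - s - 1) → Fin n) : Jet n m (r-1) → ℝ :=
  A s (fun l => (P l).1.1) (fun l => (P l).2) iv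

lemma Acomp_smooth {n m r : ℕ} (A : JetFam n m r)
    (hAs : ∀ s I σs iv, ContDiff ℝ (⊤:ℕ∞) (A s I σs iv)) (s : ℕ) (P : Fin s → PI n m r)
    (iv : Fin (n - s - 1) → Fin n) : ContDiff ℝ (⊤:ℕ∞) (Acomp A s P iv) := hAs _ _ _ _

noncomputable def fS {n m r : ℕ} (N : ℕ) (hN : r ≤ N) (A : JetFam n m r)
    (hAs : ∀ s I σs iv, ContDiff ℝ (⊤:ℕ∞) (A s I σs iv)) (s : ℕ) (P : Fin s → PI n m r)
    (iv : Fin (n - s - 1) → Fin n) : Fin n → SF n m N :=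
  Mat s (fun l => ySF N (P l).2 (P l).1.1) (fun k => xSF N (iv k))
    (pull (by omega) (Acomp A s P iv) (Acomp_smooth A hAs s P iv))

def yrow {n m r N : ℕ} (p : Jet n m N) (q : PI n m r) : Fin n → ℝ :=
  fun j => yc q.2 (addE q.1.1 j) p

noncomputable def urow {n : ℕ} (i : Fin n) : Fin n → ℝ := Pi.single i 1

lemma truncD_eq {t N : ℕ} (h : t ≤ N) (f : Jet n m t → ℝ) (hf : ContDiff ℝ (⊤:ℕ∞) f)
    (j : Fin n) (p : Jet n m N) :
    (Dt N j (pull h f hf)).1 p = truncD j f (projJet h p) +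
      ∑ q : JIdx n m t, (if (∑ i, q.2.1 i) = t then 1 else 0) *
        pdY q.1 q.2.1 f (projJet h p) * yc q.1 (addE q.2.1 j) p := by
  rw [Dt_pull', truncD, add_assoc]
  congr 1
  have h1 := Fintype.sum_of_injective
    (fun q : JIdx n m (t-1) => ((q.1, ⟨q.2.1, q.2.2.trans (Nat.sub_le t 1)⟩) : JIdx n m t))
    (fun a b h => Prod.ext (congrArg (fun x : JIdx n m t => x.1) h)
      (Subtype.ext (congrArg (fun x : JIdx n m t => x.2.1) h)))
    (fun q => yc q.1 (addE q.2.1 j) (projJet h p) * pdY q.1 q.2.1 f (projJet h p))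
    (fun q => yc q.1 (addE q.2.1 j) (projJet h p) * pdY q.1 q.2.1 f (projJet h p))
    (by
      intro q hq
      have : ¬ (∑ i, q.2.1 i) ≤ t - 1 := fun hle => hq ⟨(q.1, ⟨q.2.1, hle⟩), rfl⟩
      rw [yc, dif_neg (by rw [sum_addE]; omega), zero_mul])
    (fun q => rfl)
  rw [h1, ← Finset.sum_add_distrib]
  refine Finset.sum_congr rfl fun q _ => ?_
  have := q.2.2
  split_ifs with hq
  · have e : yc q.1 (addE q.2.1 j) (projJet h p) = 0 := by
      rw [yc, dif_neg (by rw [sum_addE]; omega)]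
    rw [e]; ring
  · rw [yc_proj h _ _ (by rw [sum_addE]; omega)]; ring

lemma det_fS {n m r : ℕ} (hn : 0 < n) (N : ℕ) (hN : r ≤ N) (A : JetFam n m r)
    (hAs : ∀ s I σs iv, ContDiff ℝ (⊤:ℕ∞) (A s I σs iv)) (s : ℕ) (P : Fin s → PI n m r)
    (iv : Fin (n - s - 1) → Fin n) (p : Jet n m N) :
    Matrix.det (Matrix.of fun k j => (Dt N j (fS N hN A hAs s P iv k)).1 p) =
      (∑ j, truncD j (Acomp A s P iv) (projJet (by omega) p) *
        Matrix.det (Matrix.of (Mat s (fun l => yrow p (P l)) (fun k => urow (iv k)) (urow j)))) +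
      ∑ q : PI n m r, (ind1 q * pdY q.2 q.1.1 (Acomp A s P iv) (projJet (by omega) p)) *
        Matrix.det (Matrix.of (Mat s (fun l => yrow p (P l)) (fun k => urow (iv k))
          (yrow p q))) := by
  rw [← det_Mat_sum hn, ← det_Mat_sum hn, ← det_Mat_add hn]
  congr 2
  funext k j
  simp only [fS, Mat]
  by_cases h0 : (k:ℕ) = 0
  · rw [dif_pos h0, dif_pos h0, truncD_eq]
    simp only [Pi.add_apply, Finset.sum_apply, Pi.smul_apply, smul_eq_mul]
    congr 1
    · simp [urow, Pi.single_apply]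
    · rw [← (Equiv.prodComm (Fin m) (MD n (r-1))).sum_comp]
      refine Finset.sum_congr rfl fun q _ => ?_
      by_cases hq : (∑ i, q.2.1 i) = r - 1 <;> simp [ind1, yrow, hq]
  · rw [dif_neg h0, dif_neg h0]
    split_ifs with h1
    · rw [Dt_ySF]; rfl
    · rw [Dt_xSF, urow, Pi.single_apply]
      simp only [eq_comm]

/-- first part of the Lagrangian -/
noncomputable def Pt {n m r : ℕ} (A : JetFam n m r) (p : Jet n m r) (s : ℕ) (hs : s ≤ n) : ℝ :=
  ((s.factorial * (n - s).factorial : ℕ) : ℝ)⁻¹ *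
      ∑ I : Fin s → MD n (r-1), ∑ σs : Fin s → Fin m,
        ∑ iv : Fin (n - s) → Fin n,
          (if ∀ l, (∑ i, (I l).1 i) = r - 1 then (1:ℝ) else 0) *
            (∑ k : Fin s, (-1:ℝ)^(k:ℕ) *
      pdY (σs k) (I k).1
        (A (s-1) (delTup k (fun l => (I l).1)) (delTup k σs)
          (fun j : Fin (n - (s-1) - 1) =>
            iv (Fin.cast (by have := k.isLt; omega : n - (s-1) - 1 = n - s) j)))
              (projJet (Nat.sub_le r 1) p)) *
            hyperJ s hs (fun l => (I l).1) σs iv p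

/-- second part of the Lagrangian -/
noncomputable def Qt {n m r : ℕ} (A : JetFam n m r) (p : Jet n m r) (s : ℕ) (hs : s ≤ n) : ℝ :=
  ((s.factorial * (n - s).factorial : ℕ) : ℝ)⁻¹ *
      ∑ I : Fin s → MD n (r-1), ∑ σs : Fin s → Fin m,
        ∑ iv : Fin (n - s) → Fin n,
          (if ∀ l, (∑ i, (I l).1 i) = r - 1 then (1:ℝ) else 0) *
            (∑ k : Fin (n - s), (-1:ℝ)^((s:ℕ) + (k:ℕ)) *
      truncD (iv k) (A s (fun l => (I l).1) σs (delTup k iv)) (projJet (Nat.sub_le r 1) p)) *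
            hyperJ s hs (fun l => (I l).1) σs iv p

lemma LagA_split {n m r : ℕ} (A : JetFam n m r) (p : Jet n m r) :
    LagA A p = ∑ s : Fin (n+1), (Pt A p s (by have := s.isLt; omega) +
      Qt A p s (by have := s.isLt; omega)) := by
  unfold LagA LagC Pt Qt
  refine Finset.sum_congr rfl fun s _ => ?_
  rw [← mul_add]
  congr 1
  simp_rw [← Finset.sum_add_distrib]
  refine Finset.sum_congr rfl fun I _ => Finset.sum_congr rfl fun σs _ =>
    Finset.sum_congr rfl fun iv _ => ?_
  unfold Lcoef
  ring

lemma sum_pairs {n m r s : ℕ} (F : (Fin s → MD n (r-1)) → (Fin s → Fin m) → ℝ) :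
    ∑ I : Fin s → MD n (r-1), ∑ σs : Fin s → Fin m, F I σs =
      ∑ P : Fin s → PI n m r, F (fun l => (P l).1) (fun l => (P l).2) := by
  rw [← Fintype.sum_prod_type',
    ← (Equiv.arrowProdEquivProdArrow (Fin s) (fun _ => MD n (r-1)) (fun _ => Fin m)).sum_comp]
  rfl

lemma hyperJ_rows {n m r N : ℕ} (hr : 1 ≤ r) (hN : r ≤ N) (s : ℕ) (hs : s ≤ n)
    (P : Fin s → PI n m r) (iv : Fin (n - s) → Fin n) (p : Jet n m N) :
    hyperJ s hs (fun l => (P l).1.1) (fun l => (P l).2) iv (projJet hN p) =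
      Matrix.det (Matrix.of (rows s (fun l => yrow p (P l)) (fun k => urow (iv k)))) := by
  rw [hyperJ_eq]
  congr 3
  funext l j
  rw [yc_proj hN _ _ (by rw [sum_addE]; have := (P l).1.2; omega)]
  rfl

lemma Pt_eq {n m r N : ℕ} (hr : 1 ≤ r) (hN : r ≤ N) (A : JetFam n m r) (p : Jet n m N)
    (s : ℕ) (hs : s + 1 ≤ n) :
    Pt A (projJet hN p) (s+1) hs = ((s.factorial * (n - s - 1).factorial : ℕ) : ℝ)⁻¹ *
      ∑ P : Fin s → PI n m r, ∑ iv : Fin (n - s - 1) → Fin n, indP P *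
        ∑ q : PI n m r, (ind1 q * pdY q.2 q.1.1 (Acomp A s P iv) (projJet (by omega) p)) *
        Matrix.det (Matrix.of (Mat s (fun l => yrow p (P l)) (fun k => urow (iv k))
          (yrow p q))) := by
  classical
  unfold Pt
  rw [sum_pairs (r := r)]
  rw [Finset.sum_comm]
  have key : ∀ iv : Fin (n - (s+1)) → Fin n,
      (∑ P : Fin (s+1) → PI n m r, (if ∀ l, (∑ i, (P l).1.1 i) = r - 1 then (1:ℝ) else 0) *
            (∑ k : Fin (s+1), (-1:ℝ)^(k:ℕ) *
      pdY (P k).2 (P k).1.1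
        (A (s+1-1) (delTup k (fun l => (P l).1.1)) (delTup k (fun l => (P l).2))
          (fun j : Fin (n - (s+1-1) - 1) =>
            iv (Fin.cast (by omega : n - (s+1-1) - 1 = n - (s+1)) j)))
              (projJet (Nat.sub_le r 1) (projJet hN p))) *
            hyperJ (s+1) hs (fun l => (P l).1.1) (fun l => (P l).2) iv (projJet hN p)) =
      ((s+1 : ℕ) : ℝ) * ∑ q : PI n m r, ∑ P : Fin s → PI n m r,
        pdY q.2 q.1.1 (Acomp A s P iv) (projJet (by omega) p) *
          ((ind1 q * indP P) * Matrix.det (Matrix.of (Mat s (fun l => yrow p (P l))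
            (fun k => urow (iv k)) (yrow p q)))) := by
    intro iv
    have h := alt_sum (α := PI n m r) (s+1) (by omega)
      (fun q P => pdY q.2 q.1.1 (Acomp A s P iv) (projJet (by omega) p))
      (fun P => indP P * Matrix.det (Matrix.of (rows (s+1) (fun l => yrow p (P l))
        (fun k => urow (iv k)))))
      (by
        intro τ P
        have := det_rows_comp (s+1) hs (fun l => yrow p (P l)) (fun k => urow (iv k)) τ 1
        rw [indP_perm]
        simp only [Equiv.Perm.sign_one, Units.val_one, Int.cast_one, mul_one] at this
        change _ * Matrix.det (Matrix.of (rows (s+1) ((fun l => yrow p (P l)) ∘ τ)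
          ((fun k => urow (iv k)) ∘ (1 : Equiv.Perm (Fin (n - (s+1))))))) = _
        rw [this]
        ring)
    have h2 : ∀ (q : PI n m r) (P : Fin s → PI n m r),
        rows (n := n) (s+1) (fun l => yrow p (consT (N := s+1) q P l)) (fun k => urow (iv k)) =
        Mat s (fun l => yrow p (P l)) (fun k => urow (iv k)) (yrow p q) := by
      intro q P
      rw [← rows_cons_left]
      congr 1
      funext l
      simp only [consT]
      split_ifs <;> rfl
    have h3 : ∀ (q : PI n m r) (P : Fin s → PI n m r),
        indP (consT (N := s+1) q P) * Matrix.det (Matrix.of (rows (n := n) (s+1)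
          (fun l => yrow p (consT (N := s+1) q P l)) (fun k => urow (iv k)))) =
        (ind1 q * indP P) * Matrix.det (Matrix.of (Mat s (fun l => yrow p (P l))
            (fun k => urow (iv k)) (yrow p q))) := by
      intro q P
      rw [indP_cons, h2]
    refine Eq.trans ?_ (h.trans ?_)
    · refine Finset.sum_congr rfl fun P _ => ?_
      rw [hyperJ_rows hr]
      have e : ∀ k : Fin (s+1), Acomp A s (delTup k P) iv =
          A (s+1-1) (delTup k (fun l => (P l).1.1)) (delTup k (fun l => (P l).2))
          (fun j : Fin (n - (s+1-1) - 1) =>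
            iv (Fin.cast (by omega : n - (s+1-1) - 1 = n - (s+1)) j)) := by
        intro k
        rw [delTup_map k P (fun q => q.1.1), delTup_map k P (fun q => q.2)]
        rfl
      simp_rw [← e]
      unfold indP
      rw [mul_comm (ite _ _ _), mul_assoc]
      rfl
    · congr 1
      refine Finset.sum_congr rfl fun q _ => Finset.sum_congr rfl fun P _ => ?_
      exact congrArg _ (h3 q P)
  refine Eq.trans (congrArg _ (Finset.sum_congr rfl fun iv _ => key iv)) ?_
  rw [← Finset.mul_sum, ← mul_assoc]
  congr 1
  · rw [Nat.factorial_succ]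
    have h1 : (n - (s+1)) = n - s - 1 := rfl
    rw [h1]
    push_cast
    have h2 : ((s:ℝ) + 1) ≠ 0 := by positivity
    have h3 : ((s.factorial : ℕ) : ℝ) ≠ 0 := by positivity
    have h4 : (((n - s - 1).factorial : ℕ) : ℝ) ≠ 0 := by positivity
    field_simp
  · rw [Finset.sum_comm (s := (Finset.univ : Finset (Fin s → PI n m r)))]
    refine Finset.sum_congr rfl fun iv _ => ?_
    rw [Finset.sum_comm]
    refine Finset.sum_congr rfl fun P _ => ?_
    rw [Finset.mul_sum]
    refine Finset.sum_congr rfl fun q _ => ?_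
    ring

lemma Qt_eq {n m r N : ℕ} (hr : 1 ≤ r) (hN : r ≤ N) (A : JetFam n m r) (p : Jet n m N)
    (s : ℕ) (hs : s < n) :
    Qt A (projJet hN p) s hs.le = ((s.factorial * (n - s - 1).factorial : ℕ) : ℝ)⁻¹ *
      ∑ P : Fin s → PI n m r, ∑ iv : Fin (n - s - 1) → Fin n, indP P *
        ∑ j, truncD j (Acomp A s P iv) (projJet (by omega) p) *
        Matrix.det (Matrix.of (Mat s (fun l => yrow p (P l)) (fun k => urow (iv k))
          (urow j))) := by
  classical
  unfold Qt
  rw [sum_pairs (r := r)]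
  have key : ∀ P : Fin s → PI n m r,
      (∑ iv : Fin (n - s) → Fin n, (if ∀ l, (∑ i, (P l).1.1 i) = r - 1 then (1:ℝ) else 0) *
            (∑ k : Fin (n - s), (-1:ℝ)^((s:ℕ) + (k:ℕ)) *
      truncD (iv k) (A s (fun l => (P l).1.1) (fun l => (P l).2) (delTup k iv))
        (projJet (Nat.sub_le r 1) (projJet hN p))) *
            hyperJ s hs.le (fun l => (P l).1.1) (fun l => (P l).2) iv (projJet hN p)) =
      ((n - s : ℕ) : ℝ) * ∑ j, ∑ iv : Fin (n - s - 1) → Fin n,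
        ((-1)^s * indP P * truncD j (Acomp A s P iv) (projJet (by omega) p)) *
          ((-1)^s * Matrix.det (Matrix.of (Mat s (fun l => yrow p (P l))
            (fun k => urow (iv k)) (urow j)))) := by
    intro P
    have h := alt_sum (α := Fin n) (n - s) (by omega)
      (fun j iv => (-1)^s * indP P * truncD j (Acomp A s P iv) (projJet (by omega) p))
      (fun iv => Matrix.det (Matrix.of (rows s (fun l => yrow p (P l))
        (fun k => urow (iv k)))))
      (by
        intro τ iv
        have := det_rows_comp s hs.le (fun l => yrow p (P l)) (fun k => urow (iv k)) 1 τ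
        simp only [Equiv.Perm.sign_one, Units.val_one, Int.cast_one, one_mul] at this
        exact this)
    have h3 : ∀ (j : Fin n) (iv : Fin (n - s - 1) → Fin n),
        Matrix.det (Matrix.of (rows (n := n) s (fun l => yrow p (P l))
          (fun k => urow (consT j iv k)))) =
        (-1)^s * Matrix.det (Matrix.of (Mat s (fun l => yrow p (P l))
            (fun k => urow (iv k)) (urow j))) := by
      intro j iv
      rw [← det_rows_cons_right s hs]
      congr 3
      funext l
      simp only [consT]
      split_ifs <;> rfl
    refine Eq.trans ?_ (h.trans ?_)
    · refine Finset.sum_congr rfl fun iv _ => ?_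
      rw [hyperJ_rows hr]
      congr 1
      rw [Finset.mul_sum]
      refine Finset.sum_congr rfl fun k _ => ?_
      unfold indP
      rw [pow_add]
      have : ∀ a b c d : ℝ, a * (b * c * d) = c * (b * a * d) := by intros; ring
      exact this _ _ _ _
    · congr 1
      refine Finset.sum_congr rfl fun q _ => Finset.sum_congr rfl fun iv _ => ?_
      exact congrArg _ (h3 q iv)
  refine Eq.trans (congrArg _ (Finset.sum_congr rfl fun P _ => key P)) ?_
  rw [← Finset.mul_sum, ← mul_assoc]
  congr 1
  · obtain ⟨t, ht⟩ : ∃ t, n - s = t + 1 := ⟨n - s - 1, by omega⟩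
    rw [ht, Nat.factorial_succ, Nat.add_sub_cancel]
    push_cast
    have h2 : ((t:ℝ) + 1) ≠ 0 := by positivity
    have h3 : ((s.factorial : ℕ) : ℝ) ≠ 0 := by positivity
    have h4 : ((t.factorial : ℕ) : ℝ) ≠ 0 := by positivity
    field_simp
  · refine Finset.sum_congr rfl fun P _ => ?_
    rw [Finset.sum_comm]
    refine Finset.sum_congr rfl fun iv _ => ?_
    rw [Finset.mul_sum]
    refine Finset.sum_congr rfl fun j _ => ?_
    have h3 : ((-1:ℝ)^s) * ((-1:ℝ)^s) = 1 := by
      rw [← mul_pow]; simp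
    linear_combination (indP P * truncD j (Acomp A s P iv) (projJet (by omega) p) *
      Matrix.det (Matrix.of (Mat s (fun l => yrow p (P l))
            (fun k => urow (iv k)) (urow j)))) * h3

lemma LagA_eq {n m r N : ℕ} (hn : 0 < n) (hr : 1 ≤ r) (hN : r ≤ N) (A : JetFam n m r)
    (hAs : ∀ s I σs iv, ContDiff ℝ (⊤:ℕ∞) (A s I σs iv)) (p : Jet n m N) :
    LagA A (projJet hN p) = ∑ s : Fin n,
      (((s:ℕ).factorial * (n - (s:ℕ) - 1).factorial : ℕ) : ℝ)⁻¹ *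
      ∑ P : Fin (s:ℕ) → PI n m r, ∑ iv : Fin (n - (s:ℕ) - 1) → Fin n, indP P *
        Matrix.det (Matrix.of fun k j => (Dt N j (fS N hN A hAs s P iv k)).1 p) := by
  rw [LagA_split, Finset.sum_add_distrib, Fin.sum_univ_succ, Fin.sum_univ_castSucc
    (f := fun s : Fin (n+1) => Qt A (projJet hN p) s (by have := s.isLt; omega))]
  have h0 : Pt A (projJet hN p) ((0 : Fin (n+1)) : ℕ) (by simp) = 0 := by
    unfold Pt
    have : ∀ f : Fin ((0 : Fin (n+1)) : ℕ) → ℝ, ∑ k, f k = 0 := by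
      intro f
      apply Finset.sum_eq_zero
      intro k
      have := k.isLt
      simp at this
    simp_rw [this]
    simp
  have h1 : Qt A (projJet hN p) ((Fin.last n : Fin (n+1)) : ℕ) (by simp) = 0 := by
    unfold Qt
    have : ∀ f : Fin (n - ((Fin.last n : Fin (n+1)) : ℕ)) → ℝ, ∑ k, f k = 0 := by
      intro f
      apply Finset.sum_eq_zero
      intro k
      have := k.isLt
      simp at this
    simp_rw [this]
    simp
  rw [h0, h1, zero_add, add_zero, ← Finset.sum_add_distrib]
  refine Finset.sum_congr rfl fun s _ => ?_
  have e1 := Pt_eq hr hN A p s s.isLt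
  have e2 := Qt_eq hr hN A p s s.isLt
  refine (congrArg₂ (· + ·) e1 e2).trans ?_
  rw [← mul_add, ← Finset.sum_add_distrib]
  congr 1
  refine Finset.sum_congr rfl fun P _ => ?_
  rw [← Finset.sum_add_distrib]
  refine Finset.sum_congr rfl fun iv _ => ?_
  rw [det_fS hn, ← mul_add, add_comm]

/-- The Lagrangian as an element of the algebra of smooth functions -/
noncomputable def LS {n m r N : ℕ} (hN : r ≤ N) (A : JetFam n m r)
    (hAs : ∀ s I σs iv, ContDiff ℝ (⊤:ℕ∞) (A s I σs iv)) : SF n m N :=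
  ∑ s : Fin n, (((s:ℕ).factorial * (n - (s:ℕ) - 1).factorial : ℕ) : ℝ)⁻¹ •
      ∑ P : Fin (s:ℕ) → PI n m r, ∑ iv : Fin (n - (s:ℕ) - 1) → Fin n, indP P •
        Matrix.det (Matrix.of fun k j => Dt N j (fS N hN A hAs s P iv k))

/-- evaluation at a point as an algebra map -/
def evA {N : ℕ} (p : Jet n m N) : SF n m N →ₐ[ℝ] ℝ :=
  (Pi.evalAlgHom ℝ (fun _ : Jet n m N => ℝ) p).comp (SF n m N).val

lemma LS_apply {n m r N : ℕ} (hn : 0 < n) (hr : 1 ≤ r) (hN : r ≤ N) (A : JetFam n m r)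
    (hAs : ∀ s I σs iv, ContDiff ℝ (⊤:ℕ∞) (A s I σs iv)) (p : Jet n m N) :
    (LS hN A hAs).1 p = LagA A (projJet hN p) := by
  rw [LagA_eq hn hr hN A hAs]
  change evA p (LS hN A hAs) = _
  unfold LS
  simp only [map_sum, map_smul, smul_eq_mul, AlgHom.map_det]
  rfl

lemma LagA_smooth {n m r : ℕ} (hn : 0 < n) (hr : 1 ≤ r) (A : JetFam n m r)
    (hAs : ∀ s I σs iv, ContDiff ℝ (⊤:ℕ∞) (A s I σs iv)) :
    ContDiff ℝ (⊤:ℕ∞) (LagA A) := by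
  have h := (LS (le_refl r) A hAs).2
  have e : (LS (le_refl r) A hAs).1 = LagA A := by
    funext p
    exact LS_apply hn hr le_rfl A hAs p
  rw [e] at h
  exact h

lemma Py_fS {n m r N : ℕ} (hr : 1 ≤ r) (hN : r ≤ N) (A : JetFam n m r)
    (hAs : ∀ s I σs iv, ContDiff ℝ (⊤:ℕ∞) (A s I σs iv)) (s : ℕ) (P : Fin s → PI n m r)
    (iv : Fin (n - s - 1) → Fin n) (k : Fin n) (σ : Fin m) (J : Fin n → ℕ)
    (hJ : r ≤ ∑ i, J i) : Py N σ J (fS N hN A hAs s P iv k) = 0 := by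
  unfold fS Mat
  split_ifs with h0 h1
  · apply Subtype.ext; funext p
    rw [Py_pull, pdY, dif_neg (by omega)]
    rfl
  · refine Py_ySF _ _ _ _ ?_
    intro h
    have := (P ⟨(k:ℕ) - 1, h1⟩).1.2
    rw [h] at this
    omega
  · exact Py_xSF _ _ _

lemma P_D_zero {S : Type*} [CommRing S] [Algebra ℝ S] {N r : ℕ} (hN : r ≤ N)
    (D : Fin n → Derivation ℝ S S) (P : (Fin n → ℕ) → Derivation ℝ S S)
    (hP1 : ∀ J i f, (∑ j, J j) ≤ N → P (addE J i) (D i f) = D i (P (addE J i) f) + P J f)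
    (hP0 : ∀ J i f, J i = 0 → P J (D i f) = D i (P J f)) (f : S)
    (hf : ∀ J : Fin n → ℕ, r ≤ ∑ i, J i → P J f = 0) (i : Fin n)
    (J : Fin n → ℕ) (hJ : ∑ i, J i = N + 1) : P J (D i f) = 0 := by
  by_cases h : J i = 0
  · rw [hP0 _ _ _ h, hf J (by omega), map_zero]
  · have e := addE_subE (K := J) (i := i) (by omega)
    have e2 := sum_addE (subE J i) i
    rw [e] at e2
    have h1 := hP1 (subE J i) i f (by omega)
    rw [e, hf J (by omega), hf (subE J i) (by omega), map_zero, add_zero] at h1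
    exact h1

lemma EN_jac {S : Type*} [CommRing S] [Algebra ℝ S] {N r : ℕ} (hn : 0 < n) (hN : r ≤ N)
    (D : Fin n → Derivation ℝ S S) (P : (Fin n → ℕ) → Derivation ℝ S S)
    (hc : ∀ i j f, D i (D j f) = D j (D i f))
    (hP1 : ∀ J i f, (∑ j, J j) ≤ N → P (addE J i) (D i f) = D i (P (addE J i) f) + P J f)
    (hP0 : ∀ J i f, J i = 0 → P J (D i f) = D i (P J f)) (f : Fin n → S)
    (hf : ∀ k, ∀ J : Fin n → ℕ, r ≤ ∑ i, J i → P J (f k) = 0) :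
    EN (N+1) D P (Matrix.det (Matrix.of fun k j => D j (f k))) = 0 := by
  rw [jac_div D hc f ⟨0, hn⟩, map_sum]
  refine Finset.sum_eq_zero fun v _ => ?_
  rw [map_zsmul]
  refine smul_eq_zero_of_right _ ?_
  refine EN_div N D P hc hP1 hP0 _ _ ?_
  intro J hJ
  rw [Derivation.leibniz, leibniz_prod', hf _ J (by omega), smul_zero, add_zero,
    Finset.sum_eq_zero, smul_zero]
  intro k _
  rw [P_D_zero hN D P hP1 hP0 _ (hf k) _ J hJ, mul_zero]

lemma ENN_jac {N r : ℕ} (hn : 0 < n) (hN : r ≤ N) (σ : Fin m) (f : Fin n → SF n m (N+1))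
    (hf : ∀ k, ∀ J : Fin n → ℕ, r ≤ ∑ i, J i → Py (N+1) σ J (f k) = 0) :
    ENN (N+1) σ (Matrix.det (Matrix.of fun k j => Dt (N+1) j (f k))) = 0 :=
  EN_jac (S := SF n m (N+1)) hn hN (fun j => Dt (N+1) j) (fun J => Py (N+1) σ J)
    (fun i j f => Dt_comm (N+1) i j f) (fun J i f hJ => Py_Dt1 N σ J i f hJ)
    (fun J i f hJ => Py_Dt0 (N+1) σ J i f hJ) f hf

lemma lin_sum_zero {S : Type*} [AddCommGroup S] [Module ℝ S] (E : S →ₗ[ℝ] S)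
    {α : Type*} [Fintype α] {β γ : α → Type*} [∀ a, Fintype (β a)] [∀ a, Fintype (γ a)]
    (c : α → ℝ) (d : ∀ a, β a → ℝ) (x : ∀ a, β a → γ a → S)
    (h : ∀ a b g, E (x a b g) = 0) :
    E (∑ a, c a • ∑ b, ∑ g, d a b • x a b g) = 0 := by
  simp [map_sum, map_smul, h]

lemma ENN_LS {n m r M : ℕ} (hn : 0 < n) (hr : 1 ≤ r) (hM : r + 1 ≤ M) (A : JetFam n m r)
    (hAs : ∀ s I σs iv, ContDiff ℝ (⊤:ℕ∞) (A s I σs iv)) (σ : Fin m) :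
    ENN M σ (LS (N := M) (by omega) A hAs) = 0 := by
  obtain ⟨N, rfl⟩ : ∃ N, M = N + 1 := ⟨M - 1, by omega⟩
  unfold LS
  refine lin_sum_zero (S := SF n m (N+1)) (ENN (N+1) σ) _ _ _ ?_
  intro s P iv
  refine ENN_jac hn (r := r) (by omega) σ _ ?_
  exact fun k J hJ => Py_fS hr _ A hAs s P iv k σ J hJ

end mainformula

/-- every hyper-Jacobian Lagrangian is variationally trivial. -/
theorem hyperJacobian_lagrangian_variationally_trivial (n m r : ℕ)
    (hn : 1 ≤ n) (hm : 1 ≤ m) (hr : 1 ≤ r)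
    (A : JetFam n m r) (hA : IsAltSym A)
    (hAs : ∀ s I σs iv, ContDiff ℝ (⊤:ℕ∞) (A s I σs iv)) :
    ∀ (σ : Fin m) (p : Jet n m (2*r)), EL σ (LagA A) p = 0 := by
  intro σ p
  have hs := LagA_smooth hn hr A hAs
  rw [EL_eq σ (LagA A) hs]
  have e : pull (N := 2*r) (by omega) (LagA A) hs = LS (N := 2*r) (by omega) A hAs := by
    apply Subtype.ext
    funext q
    exact (LS_apply hn hr (by omega) A hAs q).symm
  rw [e, ENN_LS hn hr (by omega) A hAs σ]
  rfl

end JetVar
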